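/- arXiv:1904.00892 — 5 statements merged into one kernel-verified Lean document; each statement's English description precedes it below -/
import Mathlib

section
/- (Brauer's rank-one shift theorem, characteristic polynomial form.) Let A be an n×n matrix over ℂ, let v ∈ ℂ^n be an eigenvector of A with eigenvalue λ₀ (A v = λ₀ v), and let q ∈ ℂ^n be any vector. Then the characteristic polynomials satisfy the polynomial identity (x − λ₀) · char(A + v qᵀ)(x) = (x − λ₀ − qᵀv) · char(A)(x), where v qᵀ is the rank-one matrix with entries v_i q_j and qᵀv = Σ_j q_j v_j. In particular, the multiset of eigenvalues of A + v qᵀ is obtained from that of A by replacing one copy of λ₀ with λ₀ + qᵀv. -/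
open Matrix Polynomial

/-- Brauer's rank-one shift, characteristic polynomial form:
if `A v = λ₀ v` with `v ≠ 0`, then for any `q`,
`(x − λ₀)·char(A + v qᵀ)(x) = (x − λ₀ − qᵀv)·char(A)(x)`, and the multiset of
eigenvalues of `A + v qᵀ` is that of `A` with one copy of `λ₀` replaced by
`λ₀ + qᵀv`. -/
theorem stmt7 (n : ℕ) (A : Matrix (Fin n) (Fin n) ℂ) (v q : Fin n → ℂ)
    (hv : v ≠ 0) (lam0 : ℂ) (hAv : A.mulVec v = lam0 • v) :
    (Polynomial.X - Polynomial.C lam0) * (A + Matrix.vecMulVec v q).charpoly =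
      (Polynomial.X - Polynomial.C lam0 - Polynomial.C (q ⬝ᵥ v)) * A.charpoly ∧
    (A + Matrix.vecMulVec v q).charpoly.roots + {lam0} =
      A.charpoly.roots + {lam0 + q ⬝ᵥ v} := by
  have h1 : (Polynomial.X - Polynomial.C lam0) * (A + Matrix.vecMulVec v q).charpoly =
      (Polynomial.X - Polynomial.C lam0 - Polynomial.C (q ⬝ᵥ v)) * A.charpoly := by
    obtain _ | m := n
    · exact absurd (Subsingleton.elim v 0) hv
    set t : ℂ[X] := Polynomial.X - Polynomial.C lam0 with ht
    let V : Fin (m+1) → ℂ[X] := fun i => C (v i)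
    let Q : Fin (m+1) → ℂ[X] := fun i => C (q i)
    have hMV : (charmatrix A).mulVec V = t • V := by
      have hA : (A.map C).mulVec V = C lam0 • V := by
        ext1 i
        have := congrArg C (congrFun hAv i)
        simpa [Matrix.mulVec, dotProduct, V] using this
      rw [charmatrix, Matrix.sub_mulVec, RingHom.mapMatrix_apply, hA, ht, sub_smul]
      congr 1
      ext1 i
      simp [Matrix.mulVec_diagonal]
    have hB : charmatrix (A + vecMulVec v q) = charmatrix A - vecMulVec V Q := by
      ext1 i j
      simp [charmatrix_apply, vecMulVec_apply, V, Q, sub_sub]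
    have hmul : t • charmatrix (A + vecMulVec v q) =
        charmatrix A * (Matrix.scalar (Fin (m+1)) t - vecMulVec V Q) := by
      rw [hB, mul_sub, Matrix.mul_vecMulVec, hMV, smul_sub, Matrix.smul_vecMulVec]
      congr 1
      ext1 i j
      simp [mul_comm]
    have hdet := congrArg Matrix.det hmul
    rw [Matrix.det_smul, Matrix.det_mul, ← Matrix.eval_charpoly, charpoly_vecMulVec] at hdet
    have hVQ : V ⬝ᵥ Q = C (q ⬝ᵥ v) := by
      simp [dotProduct, V, Q, mul_comm]
    rw [hVQ] at hdet
    simp only [Fintype.card_fin, Nat.add_sub_cancel, eval_sub, eval_pow, eval_X, eval_smul,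
      smul_eq_mul] at hdet
    have ht0 : t ^ m ≠ 0 := pow_ne_zero _ (X_sub_C_ne_zero lam0)
    apply mul_left_cancel₀ ht0
    change _ = t ^ m * ((t - _) * (charmatrix A).det)
    change t ^ m * (t * (charmatrix (A + vecMulVec v q)).det) = _
    linear_combination hdet
  refine ⟨h1, ?_⟩
  have h2 := congrArg Polynomial.roots h1
  rw [sub_sub, ← C_add, roots_mul, roots_mul, roots_X_sub_C, roots_X_sub_C] at h2
  · rw [add_comm, h2, add_comm]
  · exact mul_ne_zero (X_sub_C_ne_zero _) (charpoly_monic _).ne_zero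
  · exact mul_ne_zero (X_sub_C_ne_zero _) (charpoly_monic _).ne_zero
end

section
/- Let A be an N×N real skew-symmetric matrix (Aᵀ = −A), let d, λ ∈ ℝ, and let v ∈ ℝ^N satisfy A v = 0 and vᵀv = 1. Define M_λ = A − d·I + (d + λ)·v vᵀ. Then the characteristic polynomials (over ℂ) satisfy (x + d) · char(M_λ)(x) = (x − λ) · char(A − d·I)(x). Hence every eigenvalue of M_λ other than λ is of the form μ − d for some eigenvalue μ of A. -/
open Matrix Polynomial

theorem aux_det {n : Type*} [Fintype n] [DecidableEq n] (B : Matrix n n ℂ) (w : n → ℂ)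
    (t c : ℂ) (ht : t ≠ 0) (hB : B *ᵥ w = t • w) (hw : w ⬝ᵥ w = 1) :
    t * (B - c • vecMulVec w w).det = (t - c) * B.det := by
  have h1 : B - c • vecMulVec w w =
      B * (1 + replicateCol Unit ((-(c / t)) • w) * replicateRow Unit w) := by
    rw [← vecMulVec_eq, Matrix.mul_add, Matrix.mul_one, mul_vecMulVec, mulVec_smul, hB, smul_smul,
      smul_vecMulVec, sub_eq_add_neg, ← neg_smul]
    congr 2
    field_simp
  rw [h1, det_mul, det_one_add_replicateCol_mul_replicateRow, dotProduct_smul, hw]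
  simp only [smul_eq_mul]
  field_simp
  ring

/-- For a real skew-symmetric `A`, `v` with `A v = 0`, `vᵀv = 1`,
and `M_λ = A − d I + (d + λ) v vᵀ`, the characteristic polynomials over `ℂ`
satisfy `(x + d)·char(M_λ)(x) = (x − λ)·char(A − d I)(x)`. Hence every
eigenvalue of `M_λ` other than `λ` is of the form `μ − d` for an eigenvalue `μ`
of `A`. -/
theorem stmt9 (N : ℕ) (A : Matrix (Fin N) (Fin N) ℝ) (hA : Aᵀ = -A)
    (d lam : ℝ) (v : Fin N → ℝ) (hAv : A.mulVec v = 0) (hv : v ⬝ᵥ v = 1) :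
    (Polynomial.X + Polynomial.C (d : ℂ)) *
        ((A - d • (1 : Matrix (Fin N) (Fin N) ℝ) +
          (d + lam) • Matrix.vecMulVec v v).map Complex.ofReal).charpoly =
      (Polynomial.X - Polynomial.C (lam : ℂ)) *
        ((A - d • (1 : Matrix (Fin N) (Fin N) ℝ)).map Complex.ofReal).charpoly ∧
    ∀ x : ℂ,
      (((A - d • (1 : Matrix (Fin N) (Fin N) ℝ) +
          (d + lam) • Matrix.vecMulVec v v).map Complex.ofReal).charpoly).IsRoot x →
      x ≠ (lam : ℂ) →
      ∃ μ : ℂ, ((A.map Complex.ofReal).charpoly).IsRoot μ ∧ x = μ - (d : ℂ) := by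
  have key : (Polynomial.X + Polynomial.C (d : ℂ)) *
        ((A - d • (1 : Matrix (Fin N) (Fin N) ℝ) +
          (d + lam) • Matrix.vecMulVec v v).map Complex.ofReal).charpoly =
      (Polynomial.X - Polynomial.C (lam : ℂ)) *
        ((A - d • (1 : Matrix (Fin N) (Fin N) ℝ)).map Complex.ofReal).charpoly := by
    have hX : (Polynomial.X + Polynomial.C (d : ℂ)) ≠ 0 := Polynomial.X_add_C_ne_zero _
    apply mul_left_cancel₀ hX
    apply Polynomial.funext
    intro x
    by_cases ht : x + (d : ℂ) = 0
    · simp [ht]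
    simp only [eval_mul, eval_add, eval_sub, eval_X, eval_C, eval_charpoly]
    congr 1
    have hw : (fun i => (v i : ℂ)) ⬝ᵥ (fun i => (v i : ℂ)) = 1 := by
      have := congrArg Complex.ofReal hv
      simpa [dotProduct] using this
    have hA' : (A.map Complex.ofReal) *ᵥ (fun i => (v i : ℂ)) = 0 := by
      ext i
      have := congrArg Complex.ofReal (congrFun hAv i)
      simpa [mulVec, dotProduct] using this
    have hm : (A - d • (1 : Matrix (Fin N) (Fin N) ℝ)).map Complex.ofReal =
        A.map Complex.ofReal - (d : ℂ) • 1 := by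
      ext i j
      by_cases h : i = j <;> simp [Matrix.one_apply, h]
    have hm2 : (A - d • (1 : Matrix (Fin N) (Fin N) ℝ) +
          (d + lam) • Matrix.vecMulVec v v).map Complex.ofReal =
        (A - d • (1 : Matrix (Fin N) (Fin N) ℝ)).map Complex.ofReal +
          ((d : ℂ) + lam) • vecMulVec (fun i => (v i : ℂ)) (fun i => (v i : ℂ)) := by
      ext i j
      simp [vecMulVec_apply]
    have hB : (scalar (Fin N) x - (A - d • (1 : Matrix (Fin N) (Fin N) ℝ)).map Complex.ofReal) *ᵥ
        (fun i => (v i : ℂ)) = (x + d) • (fun i => (v i : ℂ)) := by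
      rw [hm, sub_mulVec, sub_mulVec, hA', smul_mulVec, one_mulVec, show scalar (Fin N) x = x • (1 : Matrix (Fin N) (Fin N) ℂ) by simp [smul_one_eq_diagonal],
        smul_mulVec, one_mulVec, add_smul]
      simp
    have := aux_det _ _ _ ((d : ℂ) + lam) ht hB hw
    rw [hm2, ← sub_sub, this]
    ring
  refine ⟨key, fun x hx hne => ⟨x + d, ?_, by ring⟩⟩
  have h := congrArg (Polynomial.eval x) key
  rw [eval_mul, eval_mul, hx.eq_zero, mul_zero] at h
  have h2 := (mul_eq_zero.mp h.symm).resolve_left (by simpa [sub_eq_zero] using hne)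
  rw [eval_charpoly] at h2
  rw [IsRoot, eval_charpoly, ← h2]
  congr 1
  ext i j
  by_cases h : i = j <;> simp [Matrix.one_apply, h]
  ring
end

section
/- For all natural numbers m and φ with φ ≤ m, the following identity of natural numbers holds: C(2m+1, 2φ) · (2m+1−2φ)!! · (2φ−1)!! = (2m+1)!! · C(m, φ), where C(·,·) is the binomial coefficient, n!! is the double factorial, and for φ = 0 the factor (2φ−1)!! is interpreted as 1. -/
/-- For `φ ≤ m`,
`C(2m+1, 2φ)·(2m+1−2φ)!!·(2φ−1)!! = (2m+1)!!·C(m, φ)` (with `(2φ−1)!! = 1`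
for `φ = 0`, which is automatic here since `2·0 − 1 = 0` in `ℕ` and `0!! = 1`). -/
theorem stmt17 (m φ : ℕ) (h : φ ≤ m) :
    Nat.choose (2 * m + 1) (2 * φ) * Nat.doubleFactorial (2 * m + 1 - 2 * φ) *
        Nat.doubleFactorial (2 * φ - 1) =
      Nat.doubleFactorial (2 * m + 1) * Nat.choose m φ := by
  obtain ⟨k, rfl⟩ := Nat.exists_eq_add_of_le h
  have e : 2 * (φ + k) + 1 - 2 * φ = 2 * k + 1 := by omega
  have h1 := Nat.choose_mul_factorial_mul_factorial
    (show 2 * φ ≤ 2 * (φ + k) + 1 by omega)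
  have h2 := Nat.choose_mul_factorial_mul_factorial h
  have e2 : φ + k - φ = k := by omega
  have h3 : Nat.factorial (2 * φ) =
      (2 ^ φ * Nat.factorial φ) * Nat.doubleFactorial (2 * φ - 1) := by
    rw [← Nat.doubleFactorial_two_mul]
    cases φ with
    | zero => simp
    | succ n => exact Nat.factorial_eq_mul_doubleFactorial (2 * n + 1)
  rw [e, h3, Nat.factorial_eq_mul_doubleFactorial, Nat.factorial_eq_mul_doubleFactorial,
    Nat.doubleFactorial_two_mul, Nat.doubleFactorial_two_mul, ← h2, e2] at h1
  rw [e]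
  have hp : 0 < 2 ^ (φ + k) * Nat.factorial φ * Nat.factorial k := by positivity
  apply Nat.eq_of_mul_eq_mul_right hp
  rw [pow_add] at h1 ⊢
  linear_combination h1
end

section
/- For every natural number m and all real numbers x and y: Σ_{φ=0}^{m} C(2m+1, 2φ) · (2m+1−2φ)!! · (2φ−1)!! · x^{2m+1−2φ} · y^{2φ} = (2m+1)!! · x · (x² + y²)^m, where for φ = 0 the factor (2φ−1)!! is interpreted as 1. -/
open Finset

theorem aux_odd (n : ℕ) :
    Nat.factorial (2 * n + 1) = Nat.doubleFactorial (2 * n + 1) * (2 ^ n * Nat.factorial n) := by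
  rw [Nat.factorial_eq_mul_doubleFactorial, Nat.doubleFactorial_two_mul]

theorem aux_even (n : ℕ) :
    Nat.factorial (2 * n) = Nat.doubleFactorial (2 * n - 1) * (2 ^ n * Nat.factorial n) := by
  cases n with
  | zero => rfl
  | succ n =>
    rw [← Nat.doubleFactorial_two_mul]
    have := Nat.factorial_eq_mul_doubleFactorial (2 * n + 1)
    rw [show 2 * (n + 1) - 1 = 2 * n + 1 by omega, show 2 * (n + 1) = 2 * n + 1 + 1 by omega,
      this, mul_comm]

theorem aux_coeff (k p : ℕ) :
    Nat.choose (2 * (k + p) + 1) (2 * p) * Nat.doubleFactorial (2 * k + 1) *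
      Nat.doubleFactorial (2 * p - 1) =
    Nat.doubleFactorial (2 * (k + p) + 1) * Nat.choose (k + p) p := by
  have h1 := Nat.choose_mul_factorial_mul_factorial (show 2 * p ≤ 2 * (k + p) + 1 by omega)
  have h2 := Nat.choose_mul_factorial_mul_factorial (show p ≤ k + p by omega)
  rw [show 2 * (k + p) + 1 - 2 * p = 2 * k + 1 by omega, aux_odd, aux_odd, aux_even, ← h2,
    Nat.add_sub_cancel, pow_add] at h1
  have hpos : 0 < 2 ^ k * 2 ^ p * (Nat.factorial k * Nat.factorial p) := by positivity
  apply Nat.eq_of_mul_eq_mul_right hpos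
  linarith

/-- For every `m : ℕ` and real `x, y`,
`Σ_{φ=0}^m C(2m+1,2φ)·(2m+1−2φ)!!·(2φ−1)!!·x^{2m+1−2φ}·y^{2φ}
  = (2m+1)!!·x·(x²+y²)^m`
(with `(2φ−1)!! = 1` for `φ = 0`, automatic via `ℕ` subtraction). -/
theorem stmt18 (m : ℕ) (x y : ℝ) :
    ∑ φ ∈ Finset.range (m + 1),
        ((Nat.choose (2 * m + 1) (2 * φ) *
            Nat.doubleFactorial (2 * m + 1 - 2 * φ) *
            Nat.doubleFactorial (2 * φ - 1) : ℕ) : ℝ) *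
          x ^ (2 * m + 1 - 2 * φ) * y ^ (2 * φ) =
      ((Nat.doubleFactorial (2 * m + 1) : ℕ) : ℝ) * x * (x ^ 2 + y ^ 2) ^ m := by
  rw [add_comm (x ^ 2), add_pow, Finset.mul_sum]
  apply Finset.sum_congr rfl
  intro p hp
  obtain ⟨k, rfl⟩ : ∃ k, m = k + p := ⟨m - p, by have := Finset.mem_range.1 hp; omega⟩
  rw [show 2 * (k + p) + 1 - 2 * p = 2 * k + 1 by omega, aux_coeff, Nat.add_sub_cancel]
  push_cast
  ring
end

section
/- Let N ≥ 1, fix i ∈ {1,…,N}, and let k₁, …, k_N be natural numbers such that k_i is odd and k_j is even for every j ≠ i; set n = k₁ + ⋯ + k_N (so n is odd). Then (n!/(k₁!⋯k_N!)) · k_i!! · ∏_{j≠i} (k_j − 1)!! = n!! · ((n−1)/2)! / ( ((k_i−1)/2)! · ∏_{j≠i} (k_j/2)! ), where for k_j = 0 the factor (k_j − 1)!! is interpreted as 1. -/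
open Finset

theorem odd_fac (a : ℕ) : (((2 * a + 1).factorial : ℕ) : ℚ) =
    ((Nat.doubleFactorial (2 * a + 1) : ℕ) : ℚ) * (2 ^ a * ((a.factorial : ℕ) : ℚ)) := by
  rw [Nat.factorial_eq_mul_doubleFactorial, Nat.doubleFactorial_two_mul]
  push_cast
  ring

theorem even_fac (a : ℕ) : (((2 * a).factorial : ℕ) : ℚ) =
    ((Nat.doubleFactorial (2 * a - 1) : ℕ) : ℚ) * (2 ^ a * ((a.factorial : ℕ) : ℚ)) := by
  cases a with
  | zero => simp
  | succ a =>
    have h := Nat.factorial_eq_mul_doubleFactorial (2 * a + 1)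
    rw [show 2 * a + 1 + 1 = 2 * (a + 1) by ring, Nat.doubleFactorial_two_mul] at h
    rw [h, show 2 * (a + 1) - 1 = 2 * a + 1 by omega]
    push_cast
    ring

theorem df_ne (a : ℕ) : ((Nat.doubleFactorial a : ℕ) : ℚ) ≠ 0 :=
  Nat.cast_ne_zero.mpr (Nat.doubleFactorial_pos a).ne'

/-- For `k_i` odd, `k_j` even for `j ≠ i`, and `n = Σ k_j`,
`(n!/(k₁!⋯k_N!)) · k_i!! · ∏_{j≠i}(k_j−1)!!
  = n!! · ((n−1)/2)! / (((k_i−1)/2)! · ∏_{j≠i}(k_j/2)!)`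
(with `(k_j−1)!! = 1` for `k_j = 0`, automatic via `ℕ` subtraction; the
divisions `(n−1)/2`, `(k_i−1)/2`, `k_j/2` are exact). -/
theorem stmt19 (N : ℕ) (hN : 1 ≤ N) (i : Fin N) (k : Fin N → ℕ)
    (hki : Odd (k i)) (hkj : ∀ j, j ≠ i → Even (k j))
    (n : ℕ) (hn : n = ∑ j, k j) :
    ((n.factorial : ℚ) / ∏ j, ((k j).factorial : ℚ)) *
        ((Nat.doubleFactorial (k i) : ℕ) : ℚ) *
        ∏ j ∈ Finset.univ.erase i, ((Nat.doubleFactorial (k j - 1) : ℕ) : ℚ) =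
      ((Nat.doubleFactorial n : ℕ) : ℚ) * ((Nat.factorial ((n - 1) / 2) : ℕ) : ℚ) /
        (((Nat.factorial ((k i - 1) / 2) : ℕ) : ℚ) *
          ∏ j ∈ Finset.univ.erase i, ((Nat.factorial (k j / 2) : ℕ) : ℚ)) := by
  obtain ⟨a, ha⟩ := hki
  have hprod : ∏ j ∈ Finset.univ.erase i, ((k j).factorial : ℚ) =
      (∏ j ∈ Finset.univ.erase i, ((Nat.doubleFactorial (k j - 1) : ℕ) : ℚ)) *
      (2 ^ (∑ j ∈ Finset.univ.erase i, k j / 2) *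
        ∏ j ∈ Finset.univ.erase i, ((Nat.factorial (k j / 2) : ℕ) : ℚ)) := by
    rw [← Finset.prod_pow_eq_pow_sum, ← Finset.prod_mul_distrib, ← Finset.prod_mul_distrib]
    refine Finset.prod_congr rfl fun j hj => ?_
    have h2 : k j = 2 * (k j / 2) := by
      have := (hkj j (Finset.ne_of_mem_erase hj)).two_dvd
      omega
    have h := even_fac (k j / 2)
    rwa [← h2] at h
  have hsum : ∑ j ∈ Finset.univ.erase i, k j =
      2 * ∑ j ∈ Finset.univ.erase i, k j / 2 := by
    rw [Finset.mul_sum]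
    refine Finset.sum_congr rfl fun j hj => ?_
    have := (hkj j (Finset.ne_of_mem_erase hj)).two_dvd
    omega
  have hn' : n = 2 * (a + ∑ j ∈ Finset.univ.erase i, k j / 2) + 1 := by
    rw [hn, ← Finset.add_sum_erase _ _ (Finset.mem_univ i), hsum, ha]
    ring
  have hP : (∏ j ∈ Finset.univ.erase i, ((Nat.doubleFactorial (k j - 1) : ℕ) : ℚ)) ≠ 0 :=
    Finset.prod_ne_zero_iff.mpr fun j _ => df_ne _
  have hF : (∏ j ∈ Finset.univ.erase i, ((Nat.factorial (k j / 2) : ℕ) : ℚ)) ≠ 0 :=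
    Finset.prod_ne_zero_iff.mpr fun j _ => Nat.cast_ne_zero.mpr (Nat.factorial_ne_zero _)
  rw [← Finset.mul_prod_erase _ _ (Finset.mem_univ i), hprod, ha]
  generalize (∏ j ∈ Finset.univ.erase i, ((Nat.doubleFactorial (k j - 1) : ℕ) : ℚ)) = P at *
  generalize (∏ j ∈ Finset.univ.erase i, ((Nat.factorial (k j / 2) : ℕ) : ℚ)) = F at *
  generalize (∑ j ∈ Finset.univ.erase i, k j / 2) = b at *
  subst hn'
  rw [show (2 * (a + b) + 1 - 1) / 2 = a + b by omega,
    show (2 * a + 1 - 1) / 2 = a by omega, odd_fac, odd_fac, pow_add]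
  have h1 := df_ne (2 * a + 1)
  have h2 : ((a.factorial : ℕ) : ℚ) ≠ 0 := Nat.cast_ne_zero.mpr (Nat.factorial_ne_zero _)
  field_simp
end
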